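/- (Half-space case of Theorem 2.2(1).) Let d ≥ 2, V : ℝ^d → ℝ smooth, Q : H → Sym_d(ℝ) and Q_∂ : ℝ^{d−1} → Sym_{d−1}(ℝ) continuous. The following are equivalent: (i) −Hess_V(x) − Q(x) is positive semidefinite for every x ∈ H and −Q_∂(x̂) is positive semidefinite for every x̂ ∈ ℝ^{d−1}; (ii) for every f ∈ C_c^∞(ℝ^d) with ∂_d f(x̂,0) = 0 for all x̂, one has ∫_H { (Lf)² − ‖Hess_f‖²_HS − ⟨Q ∇f, ∇f⟩ } dμ ≥ ∫_{ℝ^{d−1}} ⟨Q_∂(x̂) ∇̂f(x̂,0), ∇̂f(x̂,0)⟩ dμ_∂, where ∇̂f = (∂_1 f, …, ∂_{d−1} f). -/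

import Mathlib

open MeasureTheory Real

/-- Partial derivative `∂ᵢ f` on `ℝ^n = Fin n → ℝ`. -/
noncomputable def pd {n : ℕ} (i : Fin n) (f : (Fin n → ℝ) → ℝ) (x : Fin n → ℝ) : ℝ :=
  fderiv ℝ f x (Pi.single i 1)

/-- Hessian entry `∂ᵢ∂ⱼ f`. -/
noncomputable def hess {n : ℕ} (i j : Fin n) (f : (Fin n → ℝ) → ℝ) (x : Fin n → ℝ) : ℝ :=
  pd i (pd j f) x

/-- Euclidean Laplacian `Δf`. -/
noncomputable def lap {n : ℕ} (f : (Fin n → ℝ) → ℝ) (x : Fin n → ℝ) : ℝ :=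
  ∑ i, hess i i f x

/-- Weighted Laplacian `L f = Δ f + ⟨∇V, ∇f⟩`. -/
noncomputable def Lop {n : ℕ} (V f : (Fin n → ℝ) → ℝ) (x : Fin n → ℝ) : ℝ :=
  lap f x + ∑ i, pd i V x * pd i f x

/-- Squared Hilbert-Schmidt norm of the Hessian of `f`. -/
noncomputable def hessHS2 {n : ℕ} (f : (Fin n → ℝ) → ℝ) (x : Fin n → ℝ) : ℝ :=
  ∑ i, ∑ j, (hess i j f x) ^ 2

/-- The Hessian of `V` as a bilinear form evaluated at vectors `u, v`. -/
noncomputable def hessBil {n : ℕ} (V : (Fin n → ℝ) → ℝ) (x : Fin n → ℝ)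
    (u v : Fin n → ℝ) : ℝ :=
  ∑ i, ∑ j, hess i j V x * u i * v j

/-- The gradient `∇f`. -/
noncomputable def grad {n : ℕ} (f : (Fin n → ℝ) → ℝ) (x : Fin n → ℝ) : Fin n → ℝ :=
  fun i => pd i f x

/-- The closed upper half-space `H = {x ∈ ℝ^{d+1} : x_{d+1} ≥ 0}`. -/
def upperHalf (d : ℕ) : Set (Fin (d + 1) → ℝ) := {x | 0 ≤ x (Fin.last d)}

section PartialDerivatives

variable {n : ℕ} {f g V : (Fin n → ℝ) → ℝ}

lemma contDiff_pd (hf : ContDiff ℝ (⊤ : ℕ∞) f) (i : Fin n) : ContDiff ℝ (⊤ : ℕ∞) (pd i f) :=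
  (hf.fderiv_right (m := (⊤ : ℕ∞)) (by norm_cast)).clm_apply contDiff_const

lemma ContDiff.differentiable_of_top (hf : ContDiff ℝ (⊤ : ℕ∞) f) : Differentiable ℝ f :=
  hf.differentiable (by norm_num)

lemma pd_add (hf : Differentiable ℝ f) (hg : Differentiable ℝ g) (i : Fin n) (x : Fin n → ℝ) :
    pd i (fun y => f y + g y) x = pd i f x + pd i g x := by
  simp [pd, fderiv_fun_add (hf x) (hg x)]

lemma pd_sub (hf : Differentiable ℝ f) (hg : Differentiable ℝ g) (i : Fin n) (x : Fin n → ℝ) :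
    pd i (fun y => f y - g y) x = pd i f x - pd i g x := by
  simp [pd, fderiv_fun_sub (hf x) (hg x)]

lemma pd_mul (hf : Differentiable ℝ f) (hg : Differentiable ℝ g) (i : Fin n) (x : Fin n → ℝ) :
    pd i (fun y => f y * g y) x = pd i f x * g x + f x * pd i g x := by
  simp [pd, fderiv_fun_mul (hf x) (hg x)]
  ring

lemma pd_sum {ι : Type*} {s : Finset ι} {F : ι → (Fin n → ℝ) → ℝ}
    (hF : ∀ k, Differentiable ℝ (F k)) (i : Fin n) (x : Fin n → ℝ) :
    pd i (fun y => ∑ k ∈ s, F k y) x = ∑ k ∈ s, pd i (F k) x := by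
  simp [pd, fderiv_fun_sum fun k _ => hF k x]

lemma pd_exp (hf : Differentiable ℝ f) (i : Fin n) (x : Fin n → ℝ) :
    pd i (fun y => exp (f y)) x = exp (f x) * pd i f x := by
  simp [pd, fderiv_exp (hf x)]

lemma pd_sin (hf : Differentiable ℝ f) (i : Fin n) (x : Fin n → ℝ) :
    pd i (fun y => sin (f y)) x = cos (f x) * pd i f x := by
  simp [pd, fderiv_sin (hf x)]

lemma pd_cos (hf : Differentiable ℝ f) (i : Fin n) (x : Fin n → ℝ) :
    pd i (fun y => cos (f y)) x = -sin (f x) * pd i f x := by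
  simp [pd, fderiv_cos (hf x)]

lemma pd_comm (hf : ContDiff ℝ (⊤ : ℕ∞) f) (i j : Fin n) (x : Fin n → ℝ) :
    pd i (pd j f) x = pd j (pd i f) x := by
  have hd : DifferentiableAt ℝ (fderiv ℝ f) x :=
    (hf.fderiv_right (m := (⊤ : ℕ∞)) (by norm_cast)).differentiable (by norm_num) x
  have key : ∀ k l : Fin n, pd k (pd l f) x
      = fderiv ℝ (fderiv ℝ f) x (Pi.single k 1) (Pi.single l 1) := by
    intro k l
    change fderiv ℝ (fun y => fderiv ℝ f y (Pi.single l 1)) x _ = _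
    rw [fderiv_clm_apply hd (differentiableAt_const _)]
    simp
  rw [key, key]
  exact (contDiff_infty.1 hf 2).contDiffAt.isSymmSndFDerivAt (by simp) _ _

lemma pd_eq_zero_of_notMem_tsupport {x : Fin n → ℝ} (hx : x ∉ tsupport f) (i : Fin n) :
    pd i f x = 0 := by
  have : fderiv ℝ f x = 0 := by
    by_contra h
    exact hx (support_fderiv_subset ℝ h)
  simp [pd, this]

lemma contDiff_lop (hV : ContDiff ℝ (⊤ : ℕ∞) V) (hf : ContDiff ℝ (⊤ : ℕ∞) f) :
    ContDiff ℝ (⊤ : ℕ∞) (Lop V f) := by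
  unfold Lop lap hess
  refine (ContDiff.sum fun i _ => contDiff_pd (contDiff_pd hf i) i).add
    (ContDiff.sum fun i _ => (contDiff_pd hV i).mul (contDiff_pd hf i))

/-- The vector field `e^V (Lf ∇f - Hess_f ∇f)`, whose divergence gives Bochner's formula. -/
noncomputable def bochnerField (V f : (Fin n → ℝ) → ℝ) (i : Fin n) (x : Fin n → ℝ) : ℝ :=
  exp (V x) * (Lop V f x * pd i f x - ∑ j, hess i j f x * pd j f x)

lemma contDiff_bochnerField (hV : ContDiff ℝ (⊤ : ℕ∞) V) (hf : ContDiff ℝ (⊤ : ℕ∞) f)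
    (i : Fin n) : ContDiff ℝ (⊤ : ℕ∞) (bochnerField V f i) :=
  hV.exp.mul (((contDiff_lop hV hf).mul (contDiff_pd hf i)).sub
    (ContDiff.sum fun j _ => (contDiff_pd (contDiff_pd hf j) i).mul (contDiff_pd hf j)))

lemma hasCompactSupport_bochnerField (hf : HasCompactSupport f) (i : Fin n) :
    HasCompactSupport (bochnerField V f i) := by
  refine HasCompactSupport.intro hf fun x hx => ?_
  simp [bochnerField, pd_eq_zero_of_notMem_tsupport hx]

lemma sum_pd_bochnerField (hV : ContDiff ℝ (⊤ : ℕ∞) V) (hf : ContDiff ℝ (⊤ : ℕ∞) f)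
    (x : Fin n → ℝ) :
    ∑ i, pd i (bochnerField V f i) x =
      ((Lop V f x) ^ 2 - hessHS2 f x + hessBil V x (grad f x) (grad f x)) * exp (V x) := by
  have d1 := fun i => (contDiff_pd hf i).differentiable_of_top
  have d2 := fun i j => (contDiff_pd (contDiff_pd hf j) i).differentiable_of_top
  have dV := fun i => (contDiff_pd hV i).differentiable_of_top
  have hL : ∀ i, pd i (Lop V f) x = ∑ j, pd j (pd j (pd i f)) x
      + ∑ j, (pd i (pd j V) x * pd j f x + pd j V x * pd i (pd j f) x) := by
    intro i
    change pd i (fun y => ∑ j, pd j (pd j f) y + ∑ j, pd j V y * pd j f y) x = _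
    rw [pd_add (by fun_prop) (by fun_prop), pd_sum (fun j => d2 j j), pd_sum (by fun_prop)]
    congr 1
    · refine Finset.sum_congr rfl fun j _ => ?_
      rw [pd_comm (contDiff_pd hf j)]
      congr 1
      exact funext fun y => pd_comm hf i j y
    · exact Finset.sum_congr rfl fun j _ => pd_mul (dV j) (d1 j) i x
  have hB : ∀ i, pd i (bochnerField V f i) x
      = exp (V x) * (pd i V x * (Lop V f x * pd i f x - ∑ j, pd i (pd j f) x * pd j f x)
        + (pd i (Lop V f) x * pd i f x + Lop V f x * pd i (pd i f) x
          - ∑ j, (pd i (pd i (pd j f)) x * pd j f x + pd i (pd j f) x * pd i (pd j f) x))) := by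
    intro i
    have dL := (contDiff_lop hV hf).differentiable_of_top
    have dVV := hV.differentiable_of_top
    change pd i (fun y => exp (V y)
      * (Lop V f y * pd i f y - ∑ j, pd i (pd j f) y * pd j f y)) x = _
    rw [pd_mul (by fun_prop) (by fun_prop), pd_exp dVV, pd_sub (by fun_prop) (by fun_prop),
      pd_mul dL (d1 i), pd_sum (by fun_prop),
      Finset.sum_congr rfl fun j _ => pd_mul (d2 i j) (d1 j) i x]
    ring
  have hLx : Lop V f x = ∑ i, pd i (pd i f) x + ∑ i, pd i V x * pd i f x := rfl
  have e1 : ∑ i, Lop V f x * (pd i (pd i f) x + pd i V x * pd i f x) = (Lop V f x) ^ 2 := by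
    rw [← Finset.mul_sum, Finset.sum_add_distrib, ← hLx, sq]
  have e2 : ∑ i, ∑ j, pd i (pd i (pd j f)) x * pd j f x
      = ∑ i, ∑ j, pd j (pd j (pd i f)) x * pd i f x := Finset.sum_comm
  have e3 : ∑ i, ∑ j, pd j V x * pd i (pd j f) x * pd i f x
      = ∑ i, ∑ j, pd i V x * (pd i (pd j f) x * pd j f x) := by
    rw [Finset.sum_comm]
    refine Finset.sum_congr rfl fun i _ => Finset.sum_congr rfl fun j _ => ?_
    rw [pd_comm hf]; ring
  have e4 : hessBil V x (grad f x) (grad f x)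
      = ∑ i, ∑ j, pd i (pd j V) x * pd j f x * pd i f x :=
    Finset.sum_congr rfl fun i _ => Finset.sum_congr rfl fun j _ => by
      simp only [hess, grad]; ring
  have e5 : hessHS2 f x = ∑ i, ∑ j, pd i (pd j f) x * pd i (pd j f) x :=
    Finset.sum_congr rfl fun i _ => Finset.sum_congr rfl fun j _ => by simp only [hess]; ring
  rw [Finset.sum_congr rfl fun i _ => hB i, ← Finset.mul_sum, mul_comm, ← e1, e4, e5]
  congr 1
  simp only [hL, Finset.sum_add_distrib, Finset.sum_sub_distrib, mul_add, mul_sub, add_mul,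
    Finset.mul_sum, Finset.sum_mul] at e2 e3 ⊢
  rw [e2, ← e3]
  have e6 : ∑ i, pd i V x * (Lop V f x * pd i f x) = ∑ i, Lop V f x * (pd i V x * pd i f x) :=
    Finset.sum_congr rfl fun i _ => by ring
  rw [e6]
  ring

end PartialDerivatives

section HalfSpace

variable {d : ℕ}

lemma snoc_init_zero {x : Fin (d + 1) → ℝ} (hx : x (Fin.last d) = 0) :
    (Fin.snoc (Fin.init x) 0 : Fin (d + 1) → ℝ) = x := by
  rw [← hx]; exact Fin.snoc_init_self x

lemma isClosedEmbedding_snoc_zero :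
    Topology.IsClosedEmbedding fun xb : Fin d → ℝ => (Fin.snoc xb 0 : Fin (d + 1) → ℝ) :=
  Function.LeftInverse.isClosedEmbedding (f := fun x : Fin (d + 1) → ℝ => Fin.init x)
    (fun _ => Fin.init_snoc _ _) (continuous_pi fun i => continuous_apply i.castSucc)
    (Continuous.finSnoc (A := fun _ => ℝ) continuous_id continuous_const)

lemma measurableSet_upperHalf : MeasurableSet (upperHalf d) :=
  (isClosed_le continuous_const (continuous_apply _)).measurableSet

/-- Divergence theorem on the half-space for fields with vanishing normal component on the
boundary. -/
lemma integral_upperHalf_divergence_eq_zero {W : Fin (d + 1) → (Fin (d + 1) → ℝ) → ℝ}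
    (hW : ∀ i, ContDiff ℝ (⊤ : ℕ∞) (W i)) (hc : ∀ i, HasCompactSupport (W i))
    (h0 : ∀ xb : Fin d → ℝ, W (Fin.last d) (Fin.snoc xb 0) = 0) :
    ∫ x in upperHalf d, ∑ i, pd i (W i) x = 0 := by
  obtain ⟨R, hR0, hR⟩ : ∃ R : ℝ, 0 < R ∧ (⋃ i, tsupport (W i)) ⊆ Metric.ball 0 R :=
    (isCompact_iUnion fun i => hc i).isBounded.subset_ball_lt 0 0
  have hout : ∀ (x : Fin (d + 1) → ℝ) (j : Fin (d + 1)), R ≤ |x j| → ∀ i, x ∉ tsupport (W i) := by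
    intro x j hj i hx
    have h1 := hR (Set.mem_iUnion.2 ⟨i, hx⟩)
    rw [mem_ball_zero_iff] at h1
    have h2 := norm_le_pi_norm x j
    rw [Real.norm_eq_abs] at h2
    linarith
  set a : Fin (d + 1) → ℝ := fun i => if i = Fin.last d then 0 else -R with ha
  set b : Fin (d + 1) → ℝ := fun _ => R with hb
  have hab : a ≤ b := by
    intro i
    simp only [ha, hb]
    split_ifs <;> linarith
  have hsub : Set.Icc a b ⊆ upperHalf d := by
    intro x hx
    have := hx.1 (Fin.last d)
    simpa [ha, upperHalf] using this
  rw [setIntegral_eq_of_subset_of_forall_sdiff_eq_zero measurableSet_upperHalf hsub]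
  · have hdiv := integral_divergence_of_hasFDerivAt_off_countable' a b hab W
      (fun i x => fderiv ℝ (W i) x) ∅ Set.countable_empty
      (fun i => (hW i).continuous.continuousOn)
      (fun x _ i => ((hW i).differentiable_of_top x).hasFDerivAt)
      ((continuous_finsetSum _ fun i _ =>
        (contDiff_pd (hW i) i).continuous).continuousOn.integrableOn_compact isCompact_Icc)
    refine hdiv.trans (Finset.sum_eq_zero fun i _ => ?_)
    have hz : ∀ (c : ℝ), R ≤ |c| → ∀ y : Fin d → ℝ, W i (i.insertNth c y) = 0 := by
      intro c hcR y
      exact image_eq_zero_of_notMem_tsupport (hout _ i (by simpa using hcR) i)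
    have hback : ∀ y : Fin d → ℝ, W i (i.insertNth (a i) y) = 0 := by
      intro y
      by_cases hi : i = Fin.last d
      · have hx : (i.insertNth (a i) y : Fin (d + 1) → ℝ) (Fin.last d) = 0 := by
          subst hi; simp [ha]
        rw [← snoc_init_zero hx, hi]
        exact h0 _
      · exact hz _ (by simp [ha, hi, abs_of_pos hR0]) y
    simp [hback, hz (b i) (by simp [hb, abs_of_pos hR0])]
  · rintro x ⟨hxH, hx⟩
    have : ∃ j, R ≤ |x j| := by
      by_contra! h
      refine hx ⟨fun i => ?_, fun i => (abs_lt.1 (h i)).2.le⟩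
      simp only [ha]
      split_ifs with hi
      · subst hi; exact hxH
      · exact (abs_lt.1 (h i)).1.le
    obtain ⟨j, hj⟩ := this
    exact Finset.sum_eq_zero fun i _ => pd_eq_zero_of_notMem_tsupport (hout x j hj i) i

lemma pd_castSucc_snoc_eq_zero {g : (Fin (d + 1) → ℝ) → ℝ} (hg : Differentiable ℝ g)
    (h0 : ∀ xb : Fin d → ℝ, g (Fin.snoc xb 0) = 0) (j : Fin d) (xb : Fin d → ℝ) :
    pd j.castSucc g (Fin.snoc xb 0) = 0 := by
  have h1 := ((hg (Fin.snoc xb 0)).hasFDerivAt.hasLineDerivAt (Pi.single j.castSucc 1)).lineDeriv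
  rw [pd, ← h1, lineDeriv]
  have : (fun t : ℝ => g ((Fin.snoc xb 0 : Fin (d + 1) → ℝ)
      + t • (Pi.single j.castSucc 1 : Fin (d + 1) → ℝ))) = fun _ => 0 := by
    funext t
    rw [← snoc_init_zero (x := (Fin.snoc xb 0 : Fin (d + 1) → ℝ)
      + t • (Pi.single j.castSucc 1 : Fin (d + 1) → ℝ))]
    · exact h0 _
    · simp [(Fin.castSucc_lt_last j).ne']
  rw [this, deriv_const]

lemma bochnerField_last_eq_zero {V f : (Fin (d + 1) → ℝ) → ℝ} (hf : ContDiff ℝ (⊤ : ℕ∞) f)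
    (h0 : ∀ xb : Fin d → ℝ, pd (Fin.last d) f (Fin.snoc xb 0) = 0) (xb : Fin d → ℝ) :
    bochnerField V f (Fin.last d) (Fin.snoc xb 0) = 0 := by
  have h1 : ∀ j : Fin d, pd (Fin.last d) (pd j.castSucc f) (Fin.snoc xb 0) = 0 := fun j => by
    rw [pd_comm hf]
    exact pd_castSucc_snoc_eq_zero (contDiff_pd hf _).differentiable_of_top h0 j xb
  simp [bochnerField, Fin.sum_univ_castSucc, hess, h0, h1]

/-- The quadratic form of a matrix. -/
def quadForm {n : ℕ} (A : Matrix (Fin n) (Fin n) ℝ) (u : Fin n → ℝ) : ℝ :=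
  ∑ i, ∑ j, A i j * u i * u j

lemma quadForm_eq_dotProduct {n : ℕ} (A : Matrix (Fin n) (Fin n) ℝ) (u : Fin n → ℝ) :
    quadForm A u = star u ⬝ᵥ A.mulVec u := by
  simp only [quadForm, dotProduct, Matrix.mulVec, Finset.mul_sum, star_trivial]
  exact Finset.sum_congr rfl fun i _ => Finset.sum_congr rfl fun j _ => by ring

lemma quadForm_neg {n : ℕ} (A : Matrix (Fin n) (Fin n) ℝ) (u : Fin n → ℝ) :
    quadForm (-A) u = -quadForm A u := by
  simp [quadForm]

lemma Continuous.quadForm {X : Type*} [TopologicalSpace X] {n : ℕ}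
    {A : X → Matrix (Fin n) (Fin n) ℝ} {u : X → Fin n → ℝ} (hA : Continuous A)
    (hu : Continuous u) : Continuous fun x => quadForm (A x) (u x) :=
  continuous_finsetSum _ fun i _ => continuous_finsetSum _ fun j _ =>
    ((hA.matrix_elem i j).mul ((continuous_apply i).comp hu)).mul ((continuous_apply j).comp hu)

/-- Bochner's formula integrated over the half-space, for functions with Neumann boundary
condition. -/
lemma integral_upperHalf_bochner {V f : (Fin (d + 1) → ℝ) → ℝ} (hV : ContDiff ℝ (⊤ : ℕ∞) V)
    (hf : ContDiff ℝ (⊤ : ℕ∞) f) (hfc : HasCompactSupport f)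
    (h0 : ∀ xb : Fin d → ℝ, pd (Fin.last d) f (Fin.snoc xb 0) = 0)
    {Q : (Fin (d + 1) → ℝ) → Matrix (Fin (d + 1)) (Fin (d + 1)) ℝ} (hQ : Continuous Q) :
    ∫ x in upperHalf d, ((Lop V f x) ^ 2 - hessHS2 f x
        - quadForm (Q x) (fun i => pd i f x)) * exp (V x) =
      ∫ x in upperHalf d,
        quadForm ((Matrix.of fun i j => -hess i j V x) - Q x) (fun i => pd i f x)
          * exp (V x) := by
  have hpt : ∀ x, ((Lop V f x) ^ 2 - hessHS2 f x
        - quadForm (Q x) (fun i => pd i f x)) * exp (V x)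
      = (∑ i, pd i (bochnerField V f i) x)
        + quadForm ((Matrix.of fun i j => -hess i j V x) - Q x) (fun i => pd i f x)
          * exp (V x) := by
    intro x
    rw [sum_pd_bochnerField hV hf]
    simp only [quadForm, hessBil, grad, Matrix.sub_apply, Matrix.of_apply, sub_mul, neg_mul,
      Finset.sum_sub_distrib, Finset.sum_neg_distrib]
    ring
  simp only [hpt]
  rw [integral_add, integral_upperHalf_divergence_eq_zero (contDiff_bochnerField hV hf)
    (hasCompactSupport_bochnerField hfc) (bochnerField_last_eq_zero hf h0), zero_add]
  · refine Integrable.integrableOn (Continuous.integrable_of_hasCompactSupport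
      (continuous_finsetSum _ fun i _ => (contDiff_pd (contDiff_bochnerField hV hf i) i).continuous)
      (HasCompactSupport.intro hfc fun x hx => ?_))
    rw [sum_pd_bochnerField hV hf]
    have h2 : ∀ i j, pd i (pd j f) x = 0 := fun i j =>
      pd_eq_zero_of_notMem_tsupport (f := pd j f)
        (fun h => hx (tsupport_fderiv_apply_subset ℝ _ h)) i
    simp [Lop, lap, hessHS2, hessBil, grad, hess, pd_eq_zero_of_notMem_tsupport hx, h2]
  · refine Integrable.integrableOn (Continuous.integrable_of_hasCompactSupport ?_
      (HasCompactSupport.intro hfc fun x hx => ?_))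
    · refine (Continuous.quadForm (Continuous.sub (continuous_matrix fun i j => ?_) hQ)
        (continuous_pi fun i => (contDiff_pd hf i).continuous)).mul hV.continuous.rexp
      exact (contDiff_pd (contDiff_pd hV j) i).continuous.neg
    · simp [quadForm, pd_eq_zero_of_notMem_tsupport hx]

end HalfSpace

section Oscillation

variable {n m : ℕ}

lemma quadForm_smul {A : Matrix (Fin n) (Fin n) ℝ} (c : ℝ) (u : Fin n → ℝ) :
    quadForm A (fun i => c * u i) = c ^ 2 * quadForm A u := by
  simp only [quadForm, Finset.mul_sum]
  exact Finset.sum_congr rfl fun i _ => Finset.sum_congr rfl fun j _ => by ring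

lemma quadForm_rotation (A : Matrix (Fin n) (Fin n) ℝ) (u v : Fin n → ℝ) {s c : ℝ}
    (hsc : s ^ 2 + c ^ 2 = 1) :
    quadForm A (fun i => u i * s + v i * c) + quadForm A (fun i => u i * c - v i * s)
      = quadForm A v + quadForm A u := by
  simp only [quadForm, ← Finset.sum_add_distrib]
  refine Finset.sum_congr rfl fun i _ => Finset.sum_congr rfl fun j _ => ?_
  linear_combination (A i j * v i * v j + A i j * u i * u j) * hsc

/-- The linear functional `x ↦ ⟨v, x⟩`. -/
noncomputable def linearForm (v : Fin n → ℝ) : (Fin n → ℝ) →L[ℝ] ℝ :=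
  ∑ i, v i • ContinuousLinearMap.proj i

lemma pd_linearForm (v : Fin n → ℝ) (t : ℝ) (i : Fin n) (x : Fin n → ℝ) :
    pd i (fun y => t * linearForm v y) x = t * v i := by
  have : fderiv ℝ (fun y => t * linearForm v y) x = t • linearForm v :=
    (t • linearForm v).fderiv
  rw [pd, this]
  simp [linearForm, Pi.single_apply]

/-- The oscillating functions `φ sin(t⟨v, x⟩)`. -/
noncomputable def sinWave (φ : (Fin n → ℝ) → ℝ) (v : Fin n → ℝ) (t : ℝ) (x : Fin n → ℝ) : ℝ :=
  φ x * sin (t * linearForm v x)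

/-- The oscillating functions `φ cos(t⟨v, x⟩)`. -/
noncomputable def cosWave (φ : (Fin n → ℝ) → ℝ) (v : Fin n → ℝ) (t : ℝ) (x : Fin n → ℝ) : ℝ :=
  φ x * cos (t * linearForm v x)

variable {φ : (Fin n → ℝ) → ℝ} (v : Fin n → ℝ) (t : ℝ)

lemma contDiff_sinWave (hφ : ContDiff ℝ (⊤ : ℕ∞) φ) : ContDiff ℝ (⊤ : ℕ∞) (sinWave φ v t) :=
  hφ.mul (contDiff_const.mul (linearForm v).contDiff).sin

lemma contDiff_cosWave (hφ : ContDiff ℝ (⊤ : ℕ∞) φ) : ContDiff ℝ (⊤ : ℕ∞) (cosWave φ v t) :=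
  hφ.mul (contDiff_const.mul (linearForm v).contDiff).cos

lemma pd_sinWave (hφ : Differentiable ℝ φ) (i : Fin n) (x : Fin n → ℝ) :
    pd i (sinWave φ v t) x
      = pd i φ x * sin (t * linearForm v x) + t * φ x * v i * cos (t * linearForm v x) := by
  unfold sinWave
  rw [pd_mul hφ (by fun_prop), pd_sin (by fun_prop), pd_linearForm]
  ring

lemma pd_cosWave (hφ : Differentiable ℝ φ) (i : Fin n) (x : Fin n → ℝ) :
    pd i (cosWave φ v t) x
      = pd i φ x * cos (t * linearForm v x) - t * φ x * v i * sin (t * linearForm v x) := by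
  unfold cosWave
  rw [pd_mul hφ (by fun_prop), pd_cos (by fun_prop), pd_linearForm]
  ring

lemma integral_quadForm_sinWave_add_cosWave {X : Type*} [TopologicalSpace X] [T2Space X]
    [MeasurableSpace X] [OpensMeasurableSpace X] {μ : Measure X} [IsFiniteMeasureOnCompacts μ]
    {e : X → Fin n → ℝ} (he : Topology.IsClosedEmbedding e) (κ : Fin m → Fin n)
    {B : X → Matrix (Fin m) (Fin m) ℝ} (hB : Continuous B) {w : X → ℝ} (hw : Continuous w)
    (hφ : ContDiff ℝ (⊤ : ℕ∞) φ) (hφc : HasCompactSupport φ) :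
    (∫ x, quadForm (B x) (fun i => pd (κ i) (sinWave φ v t) (e x)) * w x ∂μ)
      + ∫ x, quadForm (B x) (fun i => pd (κ i) (cosWave φ v t) (e x)) * w x ∂μ
    = t ^ 2 * (∫ x, φ (e x) ^ 2 * quadForm (B x) (fun i => v (κ i)) * w x ∂μ)
      + ∫ x, quadForm (B x) (fun i => pd (κ i) φ (e x)) * w x ∂μ := by
  have hint : ∀ f : (Fin n → ℝ) → ℝ, ContDiff ℝ (⊤ : ℕ∞) f → HasCompactSupport f →
      Integrable (fun x => quadForm (B x) (fun i => pd (κ i) f (e x)) * w x) μ := by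
    intro f hf hfc
    refine Continuous.integrable_of_hasCompactSupport ((hB.quadForm (continuous_pi fun i =>
      (contDiff_pd hf (κ i)).continuous.comp he.continuous)).mul hw)
      (HasCompactSupport.intro (he.isCompact_preimage hfc) fun x hx => ?_)
    simp [quadForm, pd_eq_zero_of_notMem_tsupport (f := f) hx]
  have hint2 : Integrable (fun x => φ (e x) ^ 2 * quadForm (B x) (fun i => v (κ i)) * w x) μ := by
    refine Continuous.integrable_of_hasCompactSupport
      ((((hφ.continuous.comp he.continuous).pow 2).mul (hB.quadForm continuous_const)).mul hw)
      (HasCompactSupport.intro (he.isCompact_preimage hφc) fun x hx => ?_)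
    simp [image_eq_zero_of_notMem_tsupport (f := φ) hx]
  rw [← integral_const_mul, ← integral_add (hint _ (contDiff_sinWave v t hφ) hφc.mul_right)
    (hint _ (contDiff_cosWave v t hφ) hφc.mul_right),
    ← integral_add (hint2.const_mul _) (hint φ hφ hφc)]
  refine integral_congr_ae (Filter.Eventually.of_forall fun x => ?_)
  simp only [pd_sinWave v t hφ.differentiable_of_top, pd_cosWave v t hφ.differentiable_of_top]
  rw [← add_mul, quadForm_rotation _ _ _ (sin_sq_add_cos_sq _), quadForm_smul]
  ring

lemma le_of_forall_sq_mul_add_le {a a' c c' : ℝ}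
    (h : ∀ t : ℝ, t ^ 2 * a + c ≤ t ^ 2 * a' + c') : a ≤ a' := by
  by_contra! hlt
  have hpos : 0 < a - a' := sub_pos.2 hlt
  have h1 := h √((|c' - c| + 1) / (a - a'))
  rw [sq_sqrt (by positivity)] at h1
  have h2 : (|c' - c| + 1) / (a - a') * (a - a') = |c' - c| + 1 := by field_simp
  have := le_abs_self (c' - c)
  linarith

end Oscillation

section Localization

variable {d : ℕ} {B : (Fin (d + 1) → ℝ) → Matrix (Fin (d + 1)) (Fin (d + 1)) ℝ}
  {Bb : (Fin d → ℝ) → Matrix (Fin d) (Fin d) ℝ} {w : (Fin (d + 1) → ℝ) → ℝ}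
  {wb : (Fin d → ℝ) → ℝ}

/-- The boundary form `Bb` is dominated by the interior form `B` on gradients of smooth compactly
supported functions with Neumann boundary condition. -/
def NeumannDominated (B : (Fin (d + 1) → ℝ) → Matrix (Fin (d + 1)) (Fin (d + 1)) ℝ)
    (Bb : (Fin d → ℝ) → Matrix (Fin d) (Fin d) ℝ) (w : (Fin (d + 1) → ℝ) → ℝ)
    (wb : (Fin d → ℝ) → ℝ) : Prop :=
  ∀ f : (Fin (d + 1) → ℝ) → ℝ, ContDiff ℝ (⊤ : ℕ∞) f → HasCompactSupport f →
    (∀ xb : Fin d → ℝ, pd (Fin.last d) f (Fin.snoc xb 0) = 0) →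
    ∫ xb, quadForm (Bb xb) (fun i => pd i.castSucc f (Fin.snoc xb 0)) * wb xb
      ≤ ∫ x in upperHalf d, quadForm (B x) (fun i => pd i f x) * w x

lemma NeumannDominated.integral_sq_mul_le (h : NeumannDominated B Bb w wb) (hB : Continuous B)
    (hBb : Continuous Bb) (hw : Continuous w) (hwb : Continuous wb)
    {φ : (Fin (d + 1) → ℝ) → ℝ} (hφ : ContDiff ℝ (⊤ : ℕ∞) φ) (hφc : HasCompactSupport φ)
    (hφn : ∀ xb : Fin d → ℝ, pd (Fin.last d) φ (Fin.snoc xb 0) = 0) (v : Fin (d + 1) → ℝ)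
    (hv : ∀ xb : Fin d → ℝ, φ (Fin.snoc xb 0) * v (Fin.last d) = 0) :
    ∫ xb, φ (Fin.snoc xb 0) ^ 2 * quadForm (Bb xb) (fun i => v i.castSucc) * wb xb
      ≤ ∫ x in upperHalf d, φ x ^ 2 * quadForm (B x) v * w x := by
  refine le_of_forall_sq_mul_add_le
    (c := ∫ xb, quadForm (Bb xb) (fun i => pd i.castSucc φ (Fin.snoc xb 0)) * wb xb)
    (c' := ∫ x in upperHalf d, quadForm (B x) (fun i => pd i φ x) * w x) fun t => ?_
  rw [← integral_quadForm_sinWave_add_cosWave v t isClosedEmbedding_snoc_zero Fin.castSucc hBb hwb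
      hφ hφc]
  refine le_of_le_of_eq (add_le_add (h _ (contDiff_sinWave v t hφ) hφc.mul_right fun xb => ?_)
      (h _ (contDiff_cosWave v t hφ) hφc.mul_right fun xb => ?_))
    (integral_quadForm_sinWave_add_cosWave v t Topology.IsClosedEmbedding.id id hB hw hφ hφc)
  · rw [pd_sinWave v t hφ.differentiable_of_top, hφn, mul_assoc t, hv]; simp
  · rw [pd_cosWave v t hφ.differentiable_of_top, hφn, mul_assoc t, hv]; simp

lemma NeumannDominated.quadForm_nonneg_of_pos (h : NeumannDominated B Bb w wb)
    (hB : Continuous B) (hBb : Continuous Bb) (hw : Continuous w) (hwb : Continuous wb)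
    (hw0 : ∀ x, 0 < w x) (v : Fin (d + 1) → ℝ) {x₀ : Fin (d + 1) → ℝ}
    (hx₀ : 0 < x₀ (Fin.last d)) : 0 ≤ quadForm (B x₀) v := by
  by_contra! hneg
  have hq : Continuous fun x => quadForm (B x) v := hB.quadForm continuous_const
  have hopen : IsOpen {x : Fin (d + 1) → ℝ | quadForm (B x) v < 0 ∧ 0 < x (Fin.last d)} :=
    (isOpen_lt hq continuous_const).inter (isOpen_lt continuous_const (continuous_apply _))
  obtain ⟨r, hr, hball⟩ := Metric.nhds_basis_closedBall.mem_iff.1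
    (hopen.mem_nhds (show _ ∧ _ from ⟨hneg, hx₀⟩))
  let φ : ContDiffBump x₀ := ⟨r / 2, r, by positivity, by linarith⟩
  have hts : ∀ x ∈ tsupport φ, quadForm (B x) v < 0 ∧ 0 < x (Fin.last d) := fun x hx =>
    hball (by rwa [φ.tsupport_eq] at hx)
  have hbd : ∀ xb : Fin d → ℝ, (Fin.snoc xb 0 : Fin (d + 1) → ℝ) ∉ tsupport φ := fun xb hx => by
    simpa using (hts _ hx).2
  have hle := h.integral_sq_mul_le hB hBb hw hwb φ.contDiff φ.hasCompactSupport
    (fun xb => pd_eq_zero_of_notMem_tsupport (hbd xb) _) v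
    (fun xb => by rw [image_eq_zero_of_notMem_tsupport (hbd xb), zero_mul])
  have hz : ∀ xb : Fin d → ℝ, φ (Fin.snoc xb 0) = 0 := fun xb =>
    image_eq_zero_of_notMem_tsupport (hbd xb)
  rw [setIntegral_eq_integral_of_forall_compl_eq_zero] at hle
  · have hpos : 0 < ∫ x, -(φ x ^ 2 * quadForm (B x) v * w x) := by
      refine Continuous.integral_pos_of_hasCompactSupport_nonneg_nonzero (x := x₀)
        (((φ.continuous.pow 2).mul hq).mul hw).neg
        (HasCompactSupport.intro φ.hasCompactSupport fun x hx => ?_) (fun x => ?_) ?_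
      · simp [image_eq_zero_of_notMem_tsupport hx]
      · by_cases hx : x ∈ tsupport φ
        · have := mul_nonneg (mul_nonneg (sq_nonneg (φ x)) (neg_nonneg.2 (hts x hx).1.le))
            (hw0 x).le
          simp only [Pi.zero_apply]
          linarith
        · simp [image_eq_zero_of_notMem_tsupport hx]
      · have h1 : φ x₀ = 1 := φ.one_of_mem_closedBall (Metric.mem_closedBall_self (by positivity))
        simp [h1, hneg.ne, (hw0 x₀).ne']
    rw [integral_neg] at hpos
    simp only [hz] at hle
    simp at hle
    linarith
  · intro x hx
    have : x ∉ tsupport φ := fun hx' => hx (hts x hx').2.le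
    simp [image_eq_zero_of_notMem_tsupport this]

lemma NeumannDominated.quadForm_nonneg (h : NeumannDominated B Bb w wb)
    (hB : Continuous B) (hBb : Continuous Bb) (hw : Continuous w) (hwb : Continuous wb)
    (hw0 : ∀ x, 0 < w x) (v : Fin (d + 1) → ℝ) {x : Fin (d + 1) → ℝ}
    (hx : x ∈ upperHalf d) : 0 ≤ quadForm (B x) v := by
  have hc : Continuous fun ε : ℝ => quadForm (B (x + ε • Pi.single (Fin.last d) (1 : ℝ))) v :=
    Continuous.quadForm (hB.comp (by fun_prop)) continuous_const
  have hlim := (hc.tendsto 0).mono_left (nhdsWithin_le_nhds (s := Set.Ioi 0))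
  rw [zero_smul, add_zero] at hlim
  refine ge_of_tendsto hlim ?_
  filter_upwards [self_mem_nhdsWithin] with ε hε
  refine h.quadForm_nonneg_of_pos hB hBb hw hwb hw0 v ?_
  have h1 : 0 ≤ x (Fin.last d) := hx
  have h2 : 0 < ε := hε
  simp
  linarith

/-- Product of a bump in the boundary variables and a bump in the normal variable. -/
noncomputable def collarBump {xb : Fin d → ℝ} (ψ : ContDiffBump xb) (χ : ContDiffBump (0 : ℝ))
    (x : Fin (d + 1) → ℝ) : ℝ :=
  ψ (Fin.init x) * χ (x (Fin.last d))

section collarBump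

variable {xb : Fin d → ℝ} (ψ : ContDiffBump xb) (χ : ContDiffBump (0 : ℝ))

lemma contDiff_collarBump : ContDiff ℝ (⊤ : ℕ∞) (collarBump ψ χ) := by
  unfold collarBump
  have : ContDiff ℝ (⊤ : ℕ∞) fun x : Fin (d + 1) → ℝ => (Fin.init x : Fin d → ℝ) :=
    contDiff_pi.2 fun i => contDiff_apply ℝ ℝ i.castSucc
  exact (ψ.contDiff.comp this).mul (χ.contDiff.comp (contDiff_apply ℝ ℝ _))

lemma collarBump_nonneg (x : Fin (d + 1) → ℝ) : 0 ≤ collarBump ψ χ x :=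
  mul_nonneg ψ.nonneg χ.nonneg

lemma collarBump_le_one (x : Fin (d + 1) → ℝ) : collarBump ψ χ x ≤ 1 :=
  mul_le_one₀ ψ.le_one χ.nonneg χ.le_one

lemma isCompact_image_snoc (r s : ℝ) :
    IsCompact ((fun p : (Fin d → ℝ) × ℝ => (Fin.snoc p.1 p.2 : Fin (d + 1) → ℝ)) ''
      (Metric.closedBall xb r ×ˢ Metric.closedBall 0 s)) :=
  ((isCompact_closedBall xb r).prod (isCompact_closedBall 0 s)).image
    (Continuous.finSnoc (A := fun _ => ℝ) continuous_fst continuous_snd)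

lemma collarBump_eq_zero {s : ℝ} (hs : χ.rOut ≤ s) {x : Fin (d + 1) → ℝ}
    (hx : x ∉ (fun p : (Fin d → ℝ) × ℝ => (Fin.snoc p.1 p.2 : Fin (d + 1) → ℝ)) ''
      (Metric.closedBall xb ψ.rOut ×ˢ Metric.closedBall 0 s)) : collarBump ψ χ x = 0 := by
  by_contra hne
  refine hx ⟨(Fin.init x, x (Fin.last d)), ⟨?_, ?_⟩, Fin.snoc_init_self x⟩
  · by_contra hn
    exact hne (mul_eq_zero_of_left (ψ.zero_of_le_dist (not_le.1 hn).le) _)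
  · by_contra hn
    exact hne (mul_eq_zero_of_right _ (χ.zero_of_le_dist (hs.trans (not_le.1 hn).le)))

lemma hasCompactSupport_collarBump : HasCompactSupport (collarBump ψ χ) :=
  HasCompactSupport.intro (isCompact_image_snoc _ _) fun _ hx => collarBump_eq_zero ψ χ le_rfl hx

lemma collarBump_snoc_zero (yb : Fin d → ℝ) : collarBump ψ χ (Fin.snoc yb 0) = ψ yb := by
  simp [collarBump, χ.one_of_mem_closedBall (Metric.mem_closedBall_self χ.rIn_pos.le)]

lemma pd_last_collarBump (yb : Fin d → ℝ) :
    pd (Fin.last d) (collarBump ψ χ) (Fin.snoc yb 0) = 0 := by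
  have h1 := (((contDiff_collarBump ψ χ).differentiable_of_top
    (Fin.snoc yb 0)).hasFDerivAt.hasLineDerivAt (Pi.single (Fin.last d) 1)).lineDeriv
  rw [pd, ← h1, lineDeriv]
  have : (fun t : ℝ => collarBump ψ χ ((Fin.snoc yb 0 : Fin (d + 1) → ℝ)
      + t • (Pi.single (Fin.last d) 1 : Fin (d + 1) → ℝ))) =ᶠ[nhds 0] fun _ => ψ yb := by
    filter_upwards [χ.eventuallyEq_one] with t ht
    have hi : (Fin.init ((Fin.snoc yb 0 : Fin (d + 1) → ℝ)
        + t • (Pi.single (Fin.last d) 1 : Fin (d + 1) → ℝ)) : Fin d → ℝ) = yb := by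
      funext i
      simp [Fin.init, (Fin.castSucc_lt_last i).ne]
    rw [collarBump, hi]
    simp [ht]
  rw [this.deriv_eq, deriv_const]

end collarBump

lemma NeumannDominated.quadForm_boundary_nonpos (h : NeumannDominated B Bb w wb)
    (hB : Continuous B) (hBb : Continuous Bb) (hw : Continuous w) (hwb : Continuous wb)
    (hwb0 : ∀ x, 0 < wb x) (u : Fin d → ℝ) (xb : Fin d → ℝ) : quadForm (Bb xb) u ≤ 0 := by
  by_contra! hpos
  have hq : Continuous fun x => quadForm (Bb x) u := hBb.quadForm continuous_const
  obtain ⟨r, hr, hball⟩ := Metric.nhds_basis_closedBall.mem_iff.1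
    ((isOpen_lt continuous_const hq).mem_nhds hpos)
  let ψ : ContDiffBump xb := ⟨r / 2, r, by positivity, by linarith⟩
  have hts : ∀ x ∈ tsupport ψ, 0 < quadForm (Bb x) u := fun x hx =>
    hball (by rwa [ψ.tsupport_eq] at hx)
  have hIpos : 0 < ∫ yb, ψ yb ^ 2 * quadForm (Bb yb) u * wb yb := by
    refine Continuous.integral_pos_of_hasCompactSupport_nonneg_nonzero (x := xb)
      (((ψ.continuous.pow 2).mul hq).mul hwb)
      (HasCompactSupport.intro ψ.hasCompactSupport fun x hx => ?_) (fun x => ?_) ?_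
    · simp [image_eq_zero_of_notMem_tsupport hx]
    · by_cases hx : x ∈ tsupport ψ
      · exact mul_nonneg (mul_nonneg (sq_nonneg _) (hts x hx).le) (hwb0 x).le
      · simp [image_eq_zero_of_notMem_tsupport hx]
    · have h1 : ψ xb = 1 := ψ.one_of_mem_closedBall (Metric.mem_closedBall_self (by positivity))
      simp [h1, hpos.ne', (hwb0 xb).ne']
  let χ : ℕ → ContDiffBump (0 : ℝ) := fun k =>
    ⟨1 / ((k : ℝ) + 1) / 2, 1 / ((k : ℝ) + 1), by positivity, half_lt_self (by positivity)⟩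
  set v : Fin (d + 1) → ℝ := Fin.snoc u 0 with hv
  have hle : ∀ k, ∫ yb, ψ yb ^ 2 * quadForm (Bb yb) u * wb yb
      ≤ ∫ x in upperHalf d, collarBump ψ (χ k) x ^ 2 * quadForm (B x) v * w x := by
    intro k
    have := h.integral_sq_mul_le hB hBb hw hwb (contDiff_collarBump ψ (χ k))
      (hasCompactSupport_collarBump ψ (χ k)) (pd_last_collarBump ψ (χ k)) v (by simp [hv])
    simpa only [collarBump_snoc_zero, hv, Fin.snoc_castSucc] using this
  have hcont : Continuous fun x => quadForm (B x) v * w x :=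
    (hB.quadForm continuous_const).mul hw
  set K := (fun p : (Fin d → ℝ) × ℝ => (Fin.snoc p.1 p.2 : Fin (d + 1) → ℝ)) ''
      (Metric.closedBall xb ψ.rOut ×ˢ Metric.closedBall 0 1) with hK
  have hKc : IsCompact K := isCompact_image_snoc _ _
  have hlim : Filter.Tendsto
      (fun k => ∫ x in upperHalf d, collarBump ψ (χ k) x ^ 2 * quadForm (B x) v * w x)
      Filter.atTop (nhds (∫ _ in upperHalf d, (0 : ℝ))) := by
    refine tendsto_integral_of_dominated_convergence
      (K.indicator fun x => |quadForm (B x) v * w x|) (fun k => ?_) ?_ (fun k => ?_) ?_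
    · exact ((((contDiff_collarBump ψ (χ k)).continuous.pow 2).mul
        (hB.quadForm continuous_const)).mul hw).aestronglyMeasurable
    · exact ((integrable_indicator_iff hKc.measurableSet).2
        (hcont.abs.continuousOn.integrableOn_compact hKc)).integrableOn
    · refine Filter.Eventually.of_forall fun x => ?_
      by_cases hx : x ∈ K
      · rw [Set.indicator_of_mem hx, mul_assoc, Real.norm_eq_abs, abs_mul, abs_sq]
        exact mul_le_of_le_one_left (abs_nonneg _)
          (pow_le_one₀ (collarBump_nonneg ψ _ x) (collarBump_le_one ψ _ x))
      · have hrk : (χ k).rOut ≤ 1 := by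
          change 1 / ((k : ℝ) + 1) ≤ 1
          rw [div_le_one (by positivity)]
          linarith [(Nat.cast_nonneg k : (0 : ℝ) ≤ k)]
        rw [Set.indicator_of_notMem hx, collarBump_eq_zero ψ (χ k) hrk hx]
        simp
    · have hnull : (volume : Measure (Fin (d + 1) → ℝ)) {x | x (Fin.last d) = 0} = 0 :=
        Measure.pi_hyperplane _ _ _
      have hae : ∀ᵐ x : Fin (d + 1) → ℝ, x (Fin.last d) ≠ 0 := by
        rw [ae_iff]; simpa using hnull
      filter_upwards [ae_restrict_of_ae hae] with x hx
      refine tendsto_const_nhds.congr' ?_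
      have h0 := tendsto_one_div_add_atTop_nhds_zero_nat (𝕜 := ℝ)
      filter_upwards [h0.eventually (gt_mem_nhds (abs_pos.2 hx))] with k hk
      have : χ k (x (Fin.last d)) = 0 :=
        (χ k).zero_of_le_dist (by rw [Real.dist_eq, sub_zero]; exact hk.le)
      simp [collarBump, this]
  rw [integral_zero] at hlim
  exact absurd (ge_of_tendsto' hlim hle) (not_le.2 hIpos)

end Localization

/-- half-space case of Theorem 2.2(1): for continuous symmetric matrix
fields `Q` on `H` and `Qb` on the boundary `ℝ^{d-1}`, the curvature conditions
`−Hess_V − Q ⪰ 0` on `H` and `−Qb ⪰ 0` on the boundary hold if and only if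
`∫_H { (Lf)² − ‖Hess_f‖²_HS − ⟨Q ∇f, ∇f⟩ } dμ ≥ ∫_{∂H} ⟨Qb ∇̂f, ∇̂f⟩ dμ_∂`
for every `f ∈ C_c^∞` satisfying the Neumann condition, where `μ = e^V dx` and
`μ_∂ = e^{V(·,0)} dxb`.  (Ambient dimension is `d + 1` with `d ≥ 1`.) -/
theorem half_space_curvature_characterization_neumann
    (d : ℕ) (hd : 1 ≤ d) (V : (Fin (d + 1) → ℝ) → ℝ) (hV : ContDiff ℝ (⊤ : ℕ∞) V)
    (Q : (Fin (d + 1) → ℝ) → Matrix (Fin (d + 1)) (Fin (d + 1)) ℝ)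
    (Qb : (Fin d → ℝ) → Matrix (Fin d) (Fin d) ℝ)
    (hQc : ContinuousOn Q (upperHalf d)) (hQbc : Continuous Qb)
    (hQs : ∀ x ∈ upperHalf d, (Q x).IsSymm) (hQbs : ∀ xb, (Qb xb).IsSymm) :
    ((∀ x ∈ upperHalf d,
        ((Matrix.of fun i j => -hess i j V x) - Q x).PosSemidef)
      ∧ (∀ xb : Fin d → ℝ, (-Qb xb).PosSemidef))
    ↔ (∀ f : (Fin (d + 1) → ℝ) → ℝ, ContDiff ℝ (⊤ : ℕ∞) f → HasCompactSupport f →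
        (∀ xb : Fin d → ℝ, pd (Fin.last d) f (Fin.snoc xb 0) = 0) →
        (∫ xb : Fin d → ℝ,
            (∑ i, ∑ j, Qb xb i j * pd (Fin.castSucc i) f (Fin.snoc xb 0)
                * pd (Fin.castSucc j) f (Fin.snoc xb 0)) * exp (V (Fin.snoc xb 0)))
          ≤ ∫ x in upperHalf d,
              ((Lop V f x) ^ 2 - hessHS2 f x
                - ∑ i, ∑ j, Q x i j * pd i f x * pd j f x) * exp (V x)) := by
  let Q' : (Fin (d + 1) → ℝ) → Matrix (Fin (d + 1)) (Fin (d + 1)) ℝ := fun x =>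
    Q (Function.update x (Fin.last d) (max (x (Fin.last d)) 0))
  have hQ'c : Continuous Q' := by
    refine hQc.comp_continuous (by fun_prop) fun x => ?_
    simp [upperHalf]
  have hQ' : ∀ x ∈ upperHalf d, Q' x = Q x := by
    intro x hx
    have hx' : 0 ≤ x (Fin.last d) := hx
    simp only [Q', max_eq_left hx', Function.update_eq_self]
  let B : (Fin (d + 1) → ℝ) → Matrix (Fin (d + 1)) (Fin (d + 1)) ℝ := fun x =>
    (Matrix.of fun i j => -hess i j V x) - Q' x
  have hBc : Continuous B :=
    (continuous_matrix fun i j => (contDiff_pd (contDiff_pd hV j) i).continuous.neg).sub hQ'c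
  have hB : ∀ x ∈ upperHalf d, B x = (Matrix.of fun i j => -hess i j V x) - Q x := by
    intro x hx
    simp only [B, hQ' x hx]
  have hwb : Continuous fun xb : Fin d → ℝ => exp (V (Fin.snoc xb 0)) :=
    (hV.continuous.comp isClosedEmbedding_snoc_zero.continuous).rexp
  have hbochner : ∀ f : (Fin (d + 1) → ℝ) → ℝ, ContDiff ℝ (⊤ : ℕ∞) f → HasCompactSupport f →
      (∀ xb : Fin d → ℝ, pd (Fin.last d) f (Fin.snoc xb 0) = 0) →
      ∫ x in upperHalf d, ((Lop V f x) ^ 2 - hessHS2 f x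
        - ∑ i, ∑ j, Q x i j * pd i f x * pd j f x) * exp (V x)
      = ∫ x in upperHalf d, quadForm (B x) (fun i => pd i f x) * exp (V x) := by
    intro f hf hfc h0
    rw [← integral_upperHalf_bochner hV hf hfc h0 hQ'c]
    refine setIntegral_congr_fun measurableSet_upperHalf fun x hx => ?_
    simp only [hQ' x hx, quadForm]
  constructor
  · rintro ⟨h1, h2⟩ f hf hfc h0
    rw [hbochner f hf hfc h0]
    refine le_trans (integral_nonpos fun xb => ?_)
      (setIntegral_nonneg measurableSet_upperHalf fun x hx => ?_)
    · have := (h2 xb).dotProduct_mulVec_nonneg fun i => pd i.castSucc f (Fin.snoc xb 0)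
      rw [← quadForm_eq_dotProduct, quadForm_neg, Left.nonneg_neg_iff] at this
      exact mul_nonpos_of_nonpos_of_nonneg this (exp_pos _).le
    · rw [hB x hx, quadForm_eq_dotProduct]
      exact mul_nonneg ((h1 x hx).dotProduct_mulVec_nonneg _) (exp_pos _).le
  · intro h
    have hdom : NeumannDominated B Qb (fun x => exp (V x)) fun xb => exp (V (Fin.snoc xb 0)) :=
      fun f hf hfc h0 => (h f hf hfc h0).trans_eq (hbochner f hf hfc h0)
    refine ⟨fun x hx => .of_dotProduct_mulVec_nonneg ?_ fun v => ?_,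
      fun xb => .of_dotProduct_mulVec_nonneg ?_ fun u => ?_⟩
    · refine Matrix.IsHermitian.ext fun i j => ?_
      simp [hess, pd_comm hV i j, (hQs x hx).apply i j]
    · rw [← quadForm_eq_dotProduct, ← hB x hx]
      exact hdom.quadForm_nonneg hBc hQbc hV.continuous.rexp hwb (fun _ => exp_pos _) v hx
    · refine Matrix.IsHermitian.ext fun i j => ?_
      simp [(hQbs xb).apply i j]
    · rw [← quadForm_eq_dotProduct, quadForm_neg, Left.nonneg_neg_iff]
      exact hdom.quadForm_boundary_nonpos hBc hQbc hV.continuous.rexp hwb (fun _ => exp_pos _) u xb
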